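/- arXiv:2408.05536 — 3 statements merged into one kernel-verified Lean document; each statement's English description precedes it below -/
import Mathlib

section
/- Assume that for every x* ∈ X*, the condition 'B* T_α*(a−t) x* = 0 in U for all t ∈ [0,a]' implies x* = 0. Then for every x* ∈ X*, x*(R_α(a)x*) = 0 implies x* = 0; consequently the operator R_α(a) : X* → X is injective. -/
open MeasureTheory Set

/-- An orthonormal family in a separable inner product space is countable. -/
theorem Orthonormal.countable_index {E ι : Type*} [NormedAddCommGroup E] [InnerProductSpace ℝ E]
    [TopologicalSpace.SeparableSpace E] {v : ι → E} (hv : Orthonormal ℝ v) : Countable ι := by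
  refine Pairwise.countable_of_isOpen_disjoint (s := fun i => Metric.ball (v i) (1 / 2)) ?_
    (fun _ => Metric.isOpen_ball) (fun i => ⟨v i, Metric.mem_ball_self (by norm_num)⟩)
  intro i j hij
  refine Metric.ball_disjoint_ball ?_
  have h : ‖v i - v j‖ * ‖v i - v j‖ = 2 := by
    rw [norm_sub_mul_self_real, hv.1 i, hv.1 j, hv.2 hij]
    norm_num
  rw [dist_eq_norm]
  nlinarith [norm_nonneg (v i - v j)]

section Gramian

variable {X U : Type*} [NormedAddCommGroup X] [NormedSpace ℝ X]
  [NormedAddCommGroup U] [InnerProductSpace ℝ U]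
  {a : ℝ} {B : U →L[ℝ] X} {T : ℝ → X →L[ℝ] X} {Bstar : (X →L[ℝ] ℝ) →L[ℝ] U}

/-- If `T` is strongly continuous on `[0, a]`, then so is `s ↦ T (a - s)`. -/
theorem continuousOn_apply_const_sub
    (hT : ∀ x : X, ContinuousOn (fun s => T s x) (Icc (0 : ℝ) a)) (x : X) :
    ContinuousOn (fun s => T (a - s) x) (Icc (0 : ℝ) a) :=
  (hT x).comp (by fun_prop) fun s hs => ⟨by linarith [hs.2], by linarith [hs.1]⟩

/-- The map `s ↦ T(a-s) B B* T*(a-s) x*` is strongly measurable on `[0, a]`: it is the sum of the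
continuous maps `s ↦ x*(T(a-s) B eᵢ) T(a-s) B eᵢ` over a countable Hilbert basis `e` of `U`. -/
theorem aestronglyMeasurable_gramian_kernel [CompleteSpace U] [TopologicalSpace.SeparableSpace U]
    (hT : ∀ x : X, ContinuousOn (fun s => T s x) (Icc (0 : ℝ) a))
    (hB : ∀ (x' : X →L[ℝ] ℝ) (w : U), inner ℝ (Bstar x') w = x' (B w)) (x' : X →L[ℝ] ℝ) :
    AEStronglyMeasurable (fun s => T (a - s) (B (Bstar (x'.comp (T (a - s))))))
      (volume.restrict (Ioc (0 : ℝ) a)) := by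
  obtain ⟨w, b, -⟩ := exists_hilbertBasis ℝ U
  have : Countable w := b.orthonormal.countable_index
  refine aestronglyMeasurable_of_tendsto_ae (Filter.atTop : Filter (Finset w))
    (f := fun F s => ∑ i ∈ F, x' (T (a - s) (B (b i))) • T (a - s) (B (b i))) (fun F => ?_)
    (Filter.Eventually.of_forall fun s => ?_)
  · have hcont : ContinuousOn
        (fun s => ∑ i ∈ F, x' (T (a - s) (B (b i))) • T (a - s) (B (b i))) (Icc 0 a) :=
      continuousOn_finsetSum _ fun i _ =>
        (x'.continuous.comp_continuousOn (continuousOn_apply_const_sub hT _)).smul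
          (continuousOn_apply_const_sub hT _)
    exact (hcont.mono Ioc_subset_Icc_self).aestronglyMeasurable measurableSet_Ioc
  · have h := (b.hasSum_repr (Bstar (x'.comp (T (a - s))))).mapL ((T (a - s)).comp B)
    have hcoef : ∀ i, inner ℝ (b i) (Bstar (x'.comp (T (a - s)))) = x' (T (a - s) (B (b i))) :=
      fun i => by rw [real_inner_comm, hB]; rfl
    simpa [HasSum, b.repr_apply_apply, hcoef] using h

/-- The integrand defining the controllability Gramian is Bochner integrable. -/
theorem integrableOn_gramian_integrand [CompleteSpace U] [TopologicalSpace.SeparableSpace U]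
    {α C : ℝ} (ha : 0 ≤ a) (hα : 0 < α)
    (hT : ∀ x : X, ContinuousOn (fun s => T s x) (Icc (0 : ℝ) a))
    (hTC : ∀ s ∈ Icc (0 : ℝ) a, ‖T s‖ ≤ C)
    (hB : ∀ (x' : X →L[ℝ] ℝ) (w : U), inner ℝ (Bstar x') w = x' (B w)) (x' : X →L[ℝ] ℝ) :
    IntegrableOn (fun s => (a - s) ^ (α - 1) • T (a - s) (B (Bstar (x'.comp (T (a - s))))))
      (Ioc (0 : ℝ) a) := by
  have hpow : IntegrableOn (fun s : ℝ => (a - s) ^ (α - 1)) (Ioc (0 : ℝ) a) := by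
    have h := (intervalIntegral.intervalIntegrable_rpow' (a := 0) (b := a)
      (r := α - 1) (by linarith)).comp_sub_left a
    simp only [sub_zero, sub_self] at h
    exact (intervalIntegrable_iff_integrableOn_Ioc_of_le ha).1 h.symm
  refine hpow.smul_bdd (C * (‖B‖ * (‖Bstar‖ * (‖x'‖ * C))))
    (aestronglyMeasurable_gramian_kernel hT hB x') ?_
  filter_upwards [ae_restrict_mem measurableSet_Ioc] with s hs
  have hTs : ‖T (a - s)‖ ≤ C := hTC _ ⟨by linarith [hs.2], by linarith [hs.1]⟩
  have hC : 0 ≤ C := (norm_nonneg _).trans hTs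
  refine (ContinuousLinearMap.le_of_opNorm_le _ hTs _).trans ?_
  gcongr
  refine (B.le_opNorm _).trans ?_
  gcongr
  refine (Bstar.le_opNorm _).trans ?_
  gcongr
  refine (x'.opNorm_comp_le _).trans ?_
  gcongr

/-- If the quadratic form of the controllability Gramian vanishes at `x*`, then
`B* T*(a-t) x* = 0` for every `t ∈ [0, a]`. -/
theorem adjoint_eq_zero_of_gramian_eq_zero [CompleteSpace X] {α : ℝ} (ha : 0 < a)
    (hT : ∀ x : X, ContinuousOn (fun s => T s x) (Icc (0 : ℝ) a))
    (hB : ∀ (x' : X →L[ℝ] ℝ) (w : U), inner ℝ (Bstar x') w = x' (B w)) {x' : X →L[ℝ] ℝ}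
    (hInt : IntegrableOn
      (fun s => (a - s) ^ (α - 1) • T (a - s) (B (Bstar (x'.comp (T (a - s)))))) (Ioc (0 : ℝ) a))
    (h0 : x' (∫ s in Ioc (0 : ℝ) a,
      (a - s) ^ (α - 1) • T (a - s) (B (Bstar (x'.comp (T (a - s)))))) = 0) :
    ∀ t ∈ Icc (0 : ℝ) a, Bstar (x'.comp (T (a - t))) = 0 := by
  have hform : ∀ s, x' ((a - s) ^ (α - 1) • T (a - s) (B (Bstar (x'.comp (T (a - s)))))) =
      (a - s) ^ (α - 1) * ‖Bstar (x'.comp (T (a - s)))‖ ^ 2 := fun s => by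
    rw [map_smul, smul_eq_mul, ← real_inner_self_eq_norm_sq, hB]
    rfl
  have hInt' := x'.integrable_comp hInt
  rw [← x'.integral_comp_comm hInt] at h0
  simp only [hform] at h0 hInt'
  have hnonneg : 0 ≤ᵐ[volume.restrict (Ioc (0 : ℝ) a)]
      fun s => (a - s) ^ (α - 1) * ‖Bstar (x'.comp (T (a - s)))‖ ^ 2 := by
    filter_upwards [ae_restrict_mem measurableSet_Ioc] with s hs
    have : 0 ≤ a - s := sub_nonneg.2 hs.2
    exact mul_nonneg (Real.rpow_nonneg this _) (sq_nonneg _)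
  have hzero := (integral_eq_zero_iff_of_nonneg_ae hnonneg hInt').1 h0
  have hae : ∀ᵐ s ∂volume.restrict (Icc (0 : ℝ) a), Bstar (x'.comp (T (a - s))) = 0 := by
    rw [← restrict_Ioc_eq_restrict_Icc]
    filter_upwards [hzero, ae_restrict_mem measurableSet_Ioc,
      ae_restrict_of_ae (Measure.ae_ne volume a)] with s hs hmem hne
    have hpos : 0 < a - s := sub_pos.2 (lt_of_le_of_ne hmem.2 hne)
    simpa [(Real.rpow_pos_of_pos hpos (α - 1)).ne'] using hs
  intro t ht
  refine ext_inner_right ℝ fun w => ?_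
  have hcont : ContinuousOn (fun s => x' (T (a - s) (B w))) (Icc 0 a) :=
    x'.continuous.comp_continuousOn (continuousOn_apply_const_sub hT _)
  have heq : EqOn (fun s => x' (T (a - s) (B w))) (fun _ => 0) (Icc 0 a) := by
    refine Measure.eqOn_Icc_of_ae_eq volume ha.ne ?_ hcont continuousOn_const
    filter_upwards [hae] with s hs
    have h := hB (x'.comp (T (a - s))) w
    rw [hs, inner_zero_left] at h
    exact h.symm
  rw [hB, inner_zero_left]
  exact heq ht

end Gramian

/-- If the adjoint rank condition holds, then `x*(R_α(a)x*) = 0` implies `x* = 0`;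
consequently the controllability Gramian `R_α(a)` is injective. -/
theorem Ralpha_injective
    {X U : Type*} [NormedAddCommGroup X] [NormedSpace ℝ X] [CompleteSpace X]
    [NormedAddCommGroup U] [InnerProductSpace ℝ U] [CompleteSpace U]
    [TopologicalSpace.SeparableSpace U]
    (a M : ℝ) (ha : 0 < a) (hM : 0 < M)
    (α : ℝ) (hα : α ∈ Set.Ioo (1 / 2 : ℝ) 1)
    (B : U →L[ℝ] X)
    (Tα : ℝ → X →L[ℝ] X)
    (hTcont : ∀ x : X, ContinuousOn (fun s => Tα s x) (Set.Icc (0 : ℝ) a))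
    (hTbound : ∀ s ∈ Set.Icc (0 : ℝ) a, ‖Tα s‖ ≤ M / Real.Gamma α)
    (Bstar : (X →L[ℝ] ℝ) →L[ℝ] U)
    (hBstar : ∀ (x' : X →L[ℝ] ℝ) (w : U), (@inner ℝ U _ (Bstar x') w) = x' (B w))
    (Rα : (X →L[ℝ] ℝ) → X)
    (hRα : ∀ x' : X →L[ℝ] ℝ,
      Rα x' = ∫ s in Set.Ioc (0 : ℝ) a,
        (a - s) ^ (α - 1) • (Tα (a - s)) (B (Bstar (x'.comp (Tα (a - s))))))
    (hrank : ∀ x' : X →L[ℝ] ℝ,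
      (∀ t ∈ Set.Icc (0 : ℝ) a, Bstar (x'.comp (Tα (a - t))) = 0) → x' = 0) :
    (∀ x' : X →L[ℝ] ℝ, x' (Rα x') = 0 → x' = 0) ∧ Function.Injective Rα := by
  have hα0 : 0 < α := by linarith [hα.1]
  have hInt := integrableOn_gramian_integrand ha.le hα0 hTcont hTbound hBstar
  have hker : ∀ x' : X →L[ℝ] ℝ, x' (Rα x') = 0 → x' = 0 := fun x' h0 =>
    hrank x' (adjoint_eq_zero_of_gramian_eq_zero ha hTcont hBstar (hInt x') (hRα x' ▸ h0))
  refine ⟨hker, fun x' y' hxy => sub_eq_zero.1 (hker _ ?_)⟩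
  have hsub : Rα (x' - y') = Rα x' - Rα y' := by
    rw [hRα, hRα, hRα, ← integral_sub (hInt x') (hInt y')]
    simp only [ContinuousLinearMap.sub_comp, map_sub, smul_sub]
  rw [hsub, hxy, sub_self, map_zero]
end

section
/- Suppose there exist ε₀ ∈ (0,2) and c > 0 such that for all x, y ∈ X with ‖x‖ = 1, ‖y‖ = 1 and ‖x − y‖ ≥ 2 − ε₀, one has 1 − ‖(x+y)/2‖ ≥ c (that is, the modulus of convexity satisfies δ_X(2−ε₀) > 0). Then X satisfies James' super-reflexivity criterion: there exist an integer n ≥ 1 and ε > 0 such that for every n-tuple x₁, …, x_n ∈ X with ‖x_i‖ ≤ 1 for all i, there exists k with 1 ≤ k ≤ n such that ‖∑_{i=1}^{k} x_i − ∑_{i=k+1}^{n} x_i‖ ≤ n(1−ε). -/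
open Finset

/-- A nonzero vector lies at distance `|1 - ‖x‖|` from its normalization. -/
theorem norm_inv_norm_smul_sub_self {X : Type*} [NormedAddCommGroup X] [NormedSpace ℝ X]
    {x : X} (hx : x ≠ 0) : ‖‖x‖⁻¹ • x - x‖ = |1 - ‖x‖| := by
  have hn : ‖x‖ ≠ 0 := norm_ne_zero_iff.mpr hx
  calc ‖‖x‖⁻¹ • x - x‖ = ‖(‖x‖⁻¹ - 1) • x‖ := by rw [sub_smul, one_smul]
    _ = |‖x‖⁻¹ - 1| * |‖x‖| := by rw [norm_smul, Real.norm_eq_abs, abs_norm]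
    _ = |1 - ‖x‖| := by rw [← abs_mul, sub_mul, inv_mul_cancel₀ hn, one_mul]

/-- If the modulus of convexity of `X` satisfies `δ_X(2−ε₀) > 0` for some `ε₀ ∈ (0,2)`, then
`X` satisfies James' super-reflexivity criterion. -/
theorem modulus_convexity_implies_james_criterion
    {X : Type*} [NormedAddCommGroup X] [NormedSpace ℝ X]
    (ε₀ c : ℝ) (hε₀ : ε₀ ∈ Set.Ioo (0 : ℝ) 2) (hc : 0 < c)
    (hmod : ∀ x y : X, ‖x‖ = 1 → ‖y‖ = 1 → 2 - ε₀ ≤ ‖x - y‖ → c ≤ 1 - ‖(2 : ℝ)⁻¹ • (x + y)‖) :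
    ∃ n : ℕ, 1 ≤ n ∧ ∃ ε : ℝ, 0 < ε ∧
      ∀ x : ℕ → X, (∀ i, i < n → ‖x i‖ ≤ 1) →
        ∃ k, 1 ≤ k ∧ k ≤ n ∧
          ‖(∑ i ∈ Finset.range k, x i) - ∑ i ∈ Finset.Ico k n, x i‖ ≤ (n : ℝ) * (1 - ε) := by
  -- The criterion already holds for `n = 2`, where it says that `X` is uniformly non-square.
  obtain ⟨hε₀_pos, hε₀_lt⟩ := hε₀
  obtain ⟨ε, hε, hεε₀, hεc⟩ : ∃ ε : ℝ, 0 < ε ∧ 6 * ε ≤ ε₀ ∧ 3 * ε ≤ c :=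
    ⟨min (ε₀ / 6) (c / 3), by positivity,
      by linarith [min_le_left (ε₀ / 6) (c / 3)], by linarith [min_le_right (ε₀ / 6) (c / 3)]⟩
  refine ⟨2, one_le_two, ε, hε, fun x hx => ?_⟩
  by_contra! h
  have hsub : 2 * (1 - ε) < ‖x 0 - x 1‖ := by
    simpa using h 1 le_rfl one_le_two
  have hadd : 2 * (1 - ε) < ‖x 0 + x 1‖ := by
    simpa [Finset.sum_range_succ] using h 2 one_le_two le_rfl
  have hx₀ : ‖x 0‖ ≤ 1 := hx 0 two_pos
  have hx₁ : ‖x 1‖ ≤ 1 := hx 1 one_lt_two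
  have htri := norm_sub_le (x 0) (x 1)
  have hne₀ : x 0 ≠ 0 := norm_pos_iff.mp (by linarith)
  have hne₁ : x 1 ≠ 0 := norm_pos_iff.mp (by linarith)
  have hdist₀ := norm_inv_norm_smul_sub_self hne₀
  have hdist₁ := norm_inv_norm_smul_sub_self hne₁
  rw [abs_of_nonneg (by linarith)] at hdist₀ hdist₁
  have hunit₀ : ‖‖x 0‖⁻¹ • x 0‖ = 1 := norm_smul_inv_norm (𝕜 := ℝ) hne₀
  have hunit₁ : ‖‖x 1‖⁻¹ • x 1‖ = 1 := norm_smul_inv_norm (𝕜 := ℝ) hne₁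
  generalize ‖x 0‖⁻¹ • x 0 = u at hdist₀ hunit₀
  generalize ‖x 1‖⁻¹ • x 1 = v at hdist₁ hunit₁
  have hsub_le : ‖x 0 - x 1‖ ≤ ‖u - v‖ + (‖u - x 0‖ + ‖v - x 1‖) := by
    calc ‖x 0 - x 1‖ = ‖(u - v) - ((u - x 0) - (v - x 1))‖ := by congr 1; abel
      _ ≤ _ := (norm_sub_le _ _).trans (by gcongr; exact norm_sub_le _ _)
  have hadd_le : ‖x 0 + x 1‖ ≤ ‖u + v‖ + (‖u - x 0‖ + ‖v - x 1‖) := by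
    calc ‖x 0 + x 1‖ = ‖(u + v) - ((u - x 0) + (v - x 1))‖ := by congr 1; abel
      _ ≤ _ := (norm_sub_le _ _).trans (by gcongr; exact norm_add_le _ _)
  have hconv := hmod u v hunit₀ hunit₁ (by linarith)
  rw [norm_smul, Real.norm_of_nonneg (by norm_num)] at hconv
  linarith
end

section
/- X is uniformly smooth if and only if its topological dual X* is uniformly convex. Here X is uniformly smooth means: for every ε > 0 there exists δ > 0 such that for all x, y ∈ X with ‖x‖ = 1 and ‖y‖ ≤ δ, one has (1/2)(‖x+y‖ + ‖x−y‖) − 1 ≤ ε‖y‖. And X* is uniformly convex means: for every ε ∈ (0,2] there exists δ > 0 such that for all f, g ∈ X* with ‖f‖ ≤ 1, ‖g‖ ≤ 1 and ‖f − g‖ ≥ ε, one has ‖(f+g)/2‖ ≤ 1 − δ. -/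
/-- A nontrivial real Banach space `X` is uniformly smooth if and only if its topological dual
`X*` is uniformly convex (with the explicit ε–δ formulations). -/
theorem uniformly_smooth_iff_dual_uniformly_convex
    {X : Type*} [NormedAddCommGroup X] [NormedSpace ℝ X] [CompleteSpace X] [Nontrivial X] :
    (∀ ε : ℝ, 0 < ε → ∃ δ : ℝ, 0 < δ ∧ ∀ x y : X, ‖x‖ = 1 → ‖y‖ ≤ δ →
        (1 / 2) * (‖x + y‖ + ‖x - y‖) - 1 ≤ ε * ‖y‖) ↔
    (∀ ε ∈ Set.Ioc (0 : ℝ) 2, ∃ δ : ℝ, 0 < δ ∧ ∀ f g : X →L[ℝ] ℝ,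
        ‖f‖ ≤ 1 → ‖g‖ ≤ 1 → ε ≤ ‖f - g‖ → ‖(2 : ℝ)⁻¹ • (f + g)‖ ≤ 1 - δ) := by
  constructor
  · intro smooth ε hε
    have hε0 : 0 < ε := hε.1
    obtain ⟨δ, hδ, hsmooth⟩ := smooth (ε / 8) (by positivity)
    refine ⟨ε * δ / 8, by positivity, fun f g hf hg hfg => ?_⟩
    obtain ⟨z, hz, hfz⟩ : ∃ z : X, ‖z‖ ≤ 1 ∧ ε / 2 ≤ (f - g) z := by
      obtain ⟨z, hz, hfz⟩ :=
        (f - g).exists_lt_apply_of_lt_opNorm (show ε / 2 < ‖f - g‖ by linarith)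
      rcases le_total 0 ((f - g) z) with h | h
      · exact ⟨z, hz.le, by rw [Real.norm_of_nonneg h] at hfz; exact hfz.le⟩
      · refine ⟨-z, by rw [norm_neg]; exact hz.le, ?_⟩
        rw [Real.norm_of_nonpos h] at hfz
        rw [map_neg]
        exact hfz.le
    have hδz : ‖δ • z‖ ≤ δ := by
      rw [norm_smul, Real.norm_of_nonneg hδ.le]
      exact mul_le_of_le_one_right hδ.le hz
    have key (x : X) (hx : ‖x‖ = 1) : (f + g) x ≤ 2 - ε * δ / 4 := by
      have hs := hsmooth x (δ • z) hx hδz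
      have h₁ := (le_abs_self _).trans (f.le_of_opNorm_le hf (x + δ • z))
      have h₂ := (le_abs_self _).trans (g.le_of_opNorm_le hg (x - δ • z))
      simp only [map_add, map_sub, map_smul, smul_eq_mul, add_apply,
        sub_apply, one_mul] at *
      have h₃ := mul_le_mul_of_nonneg_left hfz hδ.le
      have h₄ := mul_le_mul_of_nonneg_left hδz hε0.le
      linarith
    have habs (x : X) (hx : ‖x‖ = 1) : |(f + g) x| ≤ 2 - ε * δ / 4 := by
      refine abs_le'.2 ⟨key x hx, ?_⟩
      rw [← map_neg]
      exact key (-x) (by rwa [norm_neg])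
    obtain ⟨x₀, hx₀⟩ := exists_norm_eq X zero_le_one
    have hnonneg := (abs_nonneg _).trans (habs x₀ hx₀)
    refine ContinuousLinearMap.opNorm_le_of_unit_norm (by linarith) fun x hx => ?_
    rw [smul_apply, norm_smul, Real.norm_eq_abs, Real.norm_eq_abs,
      abs_of_pos (by norm_num : (0 : ℝ) < 2⁻¹)]
    linarith [habs x hx]
  · intro convex ε hε
    obtain ⟨δ, hδ, hconvex⟩ := convex (min ε 2) ⟨by positivity, min_le_right _ _⟩
    refine ⟨δ, hδ, fun x y hx hy => ?_⟩
    obtain ⟨f, hf, hfx⟩ := exists_dual_vector'' ℝ (x + y)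
    obtain ⟨g, hg, hgx⟩ := exists_dual_vector'' ℝ (x - y)
    have hsum : ‖x + y‖ + ‖x - y‖ = (f + g) x + (f - g) y := by
      simp only [RCLike.ofReal_real_eq_id, id] at hfx hgx
      rw [← hfx, ← hgx]
      simp only [map_add, map_sub, add_apply, sub_apply]
      ring
    have hx' := (le_abs_self _).trans ((f + g).le_opNorm x)
    have hy' := (le_abs_self _).trans ((f - g).le_opNorm y)
    rw [hx, mul_one] at hx'
    have hyε : 0 ≤ ε * ‖y‖ := by positivity
    rcases lt_or_ge ‖f - g‖ (min ε 2) with h | h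
    · have h₁ := norm_add_le f g
      have h₂ := mul_le_mul_of_nonneg_right (h.le.trans (min_le_left _ _)) (norm_nonneg y)
      linarith
    · have h₁ := hconvex f g hf hg h
      rw [norm_smul, Real.norm_of_nonneg (by norm_num)] at h₁
      have h₂ := mul_le_mul_of_nonneg_right ((norm_sub_le f g).trans (add_le_add hf hg))
        (norm_nonneg y)
      linarith
end
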